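/- Let Λ be a countable set and let Γ be a subshift of Λ^ω which is a subshift of bounded type. Then a nonempty set Z ⊆ Γ is a closed internally chain transitive set if and only if Z is an attracting ω-limit set of the system (Γ, σ). -/

import Mathlib

open Set Filter Topology

/-- The shift map `σ` on `ℕ → Λ`, defined by `σ(x)(n) = x(n+1)`. -/
def shift {Λ : Type*} (x : ℕ → Λ) : ℕ → Λ := fun n => x (n + 1)

/-- The Baire metric `d(x,y) = inf {2^{-n} : x_i = y_i for all i < n}`. -/
noncomputable def bDist {Λ : Type*} (x y : ℕ → Λ) : ℝ :=
  sInf {r : ℝ | ∃ n : ℕ, r = (2 : ℝ)⁻¹ ^ n ∧ ∀ i < n, x i = y i}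

/-- `Γ` is a subshift: a closed, shift-invariant subset of `ℕ → Λ`. -/
def IsSubshift {Λ : Type*} [TopologicalSpace Λ] (Γ : Set (ℕ → Λ)) : Prop :=
  IsClosed Γ ∧ shift '' Γ = Γ

/-- The finite word `w` is allowed in `Γ`: it occurs as a consecutive block in some point of `Γ`. -/
def Allowed {Λ : Type*} (Γ : Set (ℕ → Λ)) (w : List Λ) : Prop :=
  ∃ x ∈ Γ, ∃ i : ℕ, ∀ (j : ℕ) (h : j < w.length), x (i + j) = w.get ⟨j, h⟩

/-- `F` is a basis for the forbidden words of `Γ`: each member of `F` is forbidden, and every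
forbidden word contains a member of `F` as a consecutive (infix) subword. -/
def IsForbiddenBasis {Λ : Type*} (Γ : Set (ℕ → Λ)) (F : Set (List Λ)) : Prop :=
  (∀ w ∈ F, ¬ Allowed Γ w) ∧ ∀ w : List Λ, ¬ Allowed Γ w → ∃ v ∈ F, v <:+: w

/-- `Γ` is a subshift of finite type: it has a finite basis for its forbidden words. -/
def IsSFT {Λ : Type*} (Γ : Set (ℕ → Λ)) : Prop :=
  ∃ F : Set (List Λ), F.Finite ∧ IsForbiddenBasis Γ F

/-- `Γ` is a subshift of bounded type: it has a basis for its forbidden words whose members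
have uniformly bounded length. -/
def IsSBT {Λ : Type*} (Γ : Set (ℕ → Λ)) : Prop :=
  ∃ F : Set (List Λ), (∃ N : ℕ, ∀ w ∈ F, w.length ≤ N) ∧ IsForbiddenBasis Γ F

/-- The ω-limit set of a sequence: `⋂_N cl {u i : i ≥ N}`. -/
def omegaSeq {X : Type*} [TopologicalSpace X] (u : ℕ → X) : Set X :=
  ⋂ N : ℕ, closure (u '' Set.Ici N)

/-- The ω-limit set of a point under the shift map. -/
def omegaPt {Λ : Type*} [TopologicalSpace Λ] (x : ℕ → Λ) : Set (ℕ → Λ) :=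
  omegaSeq fun i => shift^[i] x

/-- `A` is internally chain transitive for the shift (w.r.t. the Baire metric): for all
`a, b ∈ A` and `δ > 0` there is a `δ`-chain from `a` to `b` consisting of elements of `A`. -/
def IsICT {Λ : Type*} (A : Set (ℕ → Λ)) : Prop :=
  ∀ a ∈ A, ∀ b ∈ A, ∀ δ : ℝ, 0 < δ → ∃ n : ℕ, 1 ≤ n ∧
    ∃ c : ℕ → (ℕ → Λ), c 0 = a ∧ c n = b ∧ (∀ i ≤ n, c i ∈ A) ∧
      ∀ i < n, bDist (shift (c i)) (c (i + 1)) < δ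

/-- Distance from a point to a set, w.r.t. the Baire metric. -/
noncomputable def bInfDist {Λ : Type*} (x : ℕ → Λ) (Z : Set (ℕ → Λ)) : ℝ :=
  sInf (bDist x '' Z)

theorem shift_iterate_apply {Λ : Type*} (x : ℕ → Λ) (i j : ℕ) : shift^[i] x j = x (i + j) := by
  induction i generalizing x with
  | zero => simp
  | succ i ih =>
    rw [Function.iterate_succ_apply, ih]
    exact congrArg x (by omega)

theorem bDist_nonneg {Λ : Type*} (x y : ℕ → Λ) : 0 ≤ bDist x y := by
  refine Real.sInf_nonneg ?_
  rintro _ ⟨n, rfl, -⟩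
  positivity

theorem bDist_lt_of_agree {Λ : Type*} {x y : ℕ → Λ} {n : ℕ} (h : ∀ i < n + 1, x i = y i) :
    bDist x y < (2 : ℝ)⁻¹ ^ n := by
  refine lt_of_le_of_lt (csInf_le ⟨0, ?_⟩ ⟨n + 1, rfl, h⟩)
    (pow_lt_pow_right_of_lt_one₀ (by norm_num) (by norm_num) n.lt_succ_self)
  rintro _ ⟨m, rfl, -⟩
  positivity

theorem agree_of_bDist_lt {Λ : Type*} {x y : ℕ → Λ} {n : ℕ} (h : bDist x y < (2 : ℝ)⁻¹ ^ n) :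
    ∀ i < n, x i = y i := by
  obtain ⟨_, ⟨m, rfl, hm⟩, hlt⟩ := exists_lt_of_csInf_lt (by exact ⟨1, 0, by simp, by simp⟩) h
  have hnm : n < m := (pow_lt_pow_iff_right_of_lt_one₀ (by norm_num) (by norm_num)).1 hlt
  exact fun i hi => hm i (hi.trans hnm)

theorem exists_half_pow_lt {δ : ℝ} (hδ : 0 < δ) : ∃ n : ℕ, (2 : ℝ)⁻¹ ^ n < δ :=
  exists_pow_lt_of_lt_one hδ (by norm_num)

theorem bInfDist_lt_of_agree {Λ : Type*} {x z : ℕ → Λ} {Z : Set (ℕ → Λ)} {n : ℕ} (hz : z ∈ Z)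
    (h : ∀ i < n + 1, x i = z i) : bInfDist x Z < (2 : ℝ)⁻¹ ^ n := by
  refine lt_of_le_of_lt (csInf_le ⟨0, ?_⟩ ⟨z, hz, rfl⟩) (bDist_lt_of_agree h)
  rintro _ ⟨y, -, rfl⟩
  exact bDist_nonneg x y

theorem exists_agree_of_bInfDist_lt {Λ : Type*} {x : ℕ → Λ} {Z : Set (ℕ → Λ)} {n : ℕ}
    (hne : Z.Nonempty) (h : bInfDist x Z < (2 : ℝ)⁻¹ ^ n) : ∃ z ∈ Z, ∀ i < n, x i = z i := by
  obtain ⟨_, ⟨z, hz, rfl⟩, hlt⟩ := exists_lt_of_csInf_lt (hne.image _) h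
  exact ⟨z, hz, agree_of_bDist_lt hlt⟩

theorem mem_closure_iff_agree {Λ : Type*} [TopologicalSpace Λ] [DiscreteTopology Λ]
    {S : Set (ℕ → Λ)} {x : ℕ → Λ} :
    x ∈ closure S ↔ ∀ n : ℕ, ∃ y ∈ S, ∀ i < n, y i = x i := by
  rw [(PiNat.isTopologicalBasis_cylinders (fun _ : ℕ => Λ)).mem_closure_iff]
  constructor
  · intro h n
    obtain ⟨y, hy, hyS⟩ := h _ ⟨x, n, rfl⟩ (PiNat.self_mem_cylinder x n)
    exact ⟨y, hyS, hy⟩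
  · rintro h _ ⟨w, n, rfl⟩ hx
    obtain ⟨y, hyS, hy⟩ := h n
    exact ⟨y, fun i hi => (hy i hi).trans (hx i hi), hyS⟩

theorem mem_omegaPt_iff_agree {Λ : Type*} [TopologicalSpace Λ] [DiscreteTopology Λ]
    {x y : ℕ → Λ} :
    y ∈ omegaPt x ↔ ∀ N n : ℕ, ∃ k ≥ N, ∀ i < n, x (k + i) = y i := by
  simp only [omegaPt, omegaSeq, mem_iInter, mem_closure_iff_agree, exists_mem_image, mem_Ici,
    shift_iterate_apply, ge_iff_le]

theorem isClosed_omegaPt {Λ : Type*} [TopologicalSpace Λ] (x : ℕ → Λ) : IsClosed (omegaPt x) :=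
  isClosed_iInter fun _ => isClosed_closure

/-- An attracting ω-limit set is internally chain transitive. -/
theorem isICT_omegaPt {Λ : Type*} [TopologicalSpace Λ] [DiscreteTopology Λ] (x : ℕ → Λ)
    (hatt : ∀ ε : ℝ, 0 < ε → ∃ N : ℕ, ∀ i : ℕ, N ≤ i → bInfDist (shift^[i] x) (omegaPt x) < ε) :
    IsICT (omegaPt x) := by
  intro a ha b hb δ hδ
  obtain ⟨n, hn⟩ := exists_half_pow_lt hδ
  obtain ⟨N, hN⟩ := hatt ((2 : ℝ)⁻¹ ^ (n + 2)) (by positivity)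
  have hnear : ∀ i, N ≤ i → ∃ z ∈ omegaPt x, ∀ l < n + 2, shift^[i] x l = z l :=
    fun i hi => exists_agree_of_bInfDist_lt ⟨a, ha⟩ (hN i hi)
  have : Nonempty (ℕ → Λ) := ⟨a⟩
  choose! z hzZ hz using hnear
  simp only [shift_iterate_apply] at hz
  obtain ⟨i, hi, hai⟩ := mem_omegaPt_iff_agree.1 ha N (n + 2)
  obtain ⟨j, hj, hbj⟩ := mem_omegaPt_iff_agree.1 hb (i + 1) (n + 2)
  set c : ℕ → ℕ → Λ := fun k => if k = 0 then a else if k = j - i then b else z (i + k) with hc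
  have hcZ : ∀ k, c k ∈ omegaPt x := by
    intro k
    simp only [hc]
    split_ifs
    exacts [ha, hb, hzZ _ (by omega)]
  have hcx : ∀ k, ∀ l < n + 2, x (i + k + l) = c k l := by
    intro k l hl
    simp only [hc]
    split_ifs with h0 h1
    · subst h0; exact hai l hl
    · rw [show i + k = j by omega]; exact hbj l hl
    · exact hz _ (by omega) l hl
  refine ⟨j - i, by omega, c, by simp [hc], ?_, fun k _ => hcZ k, fun k _ => ?_⟩
  · have : j - i ≠ 0 := by omega
    simp [hc, this]
  · refine (bDist_lt_of_agree fun l hl => ?_).trans hn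
    rw [shift, ← hcx k (l + 1) (by omega), ← hcx (k + 1) l (by omega)]
    exact congrArg x (by omega)

/-- Finite chains `c s` from `t s` to `t (s + 1)` concatenate to an infinite chain `z`; the number
`stage k` records which finite chain the step from `z k` to `z (k + 1)` belongs to. -/
theorem exists_concat_chains {X : Type*} {A : Set X} (R : ℕ → X → X → Prop) (t : ℕ → X)
    (h : ∀ s, ∃ n : ℕ, 1 ≤ n ∧ ∃ c : ℕ → X, c 0 = t s ∧ c n = t (s + 1) ∧ (∀ i ≤ n, c i ∈ A) ∧
      ∀ i < n, R s (c i) (c (i + 1))) :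
    ∃ (z : ℕ → X) (stage : ℕ → ℕ), Monotone stage ∧ (∀ s, ∃ k ≥ s, stage k = s ∧ z k = t s) ∧
      (∀ k, z k ∈ A) ∧ ∀ k, R (stage k) (z k) (z (k + 1)) := by
  choose L hL c hc0 hcL hcA hcR using h
  let next : ℕ × ℕ → ℕ × ℕ := fun q => if q.2 + 1 < L q.1 then (q.1, q.2 + 1) else (q.1 + 1, 0)
  let q : ℕ → ℕ × ℕ := fun k => next^[k] (0, 0)
  have hq : ∀ k, q (k + 1) = next (q k) := fun k => Function.iterate_succ_apply' _ _ _
  have hlt : ∀ k, (q k).2 < L (q k).1 := by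
    intro k
    induction k with
    | zero => exact hL 0
    | succ k ih =>
      rw [hq]
      by_cases hk : (q k).2 + 1 < L (q k).1
      · simp [next, hk]
      · simpa [next, hk] using Nat.lt_of_succ_le (hL _)
  have hstart : ∀ s, ∃ k ≥ s, q k = (s, 0) := by
    intro s
    induction s with
    | zero => exact ⟨0, le_rfl, rfl⟩
    | succ s ih =>
      obtain ⟨k, hks, hk⟩ := ih
      have hrun : ∀ p < L s, q (k + p) = (s, p) := by
        intro p
        induction p with
        | zero => exact fun _ => hk
        | succ p ihp =>
          intro hp
          rw [← add_assoc, hq, ihp (by omega)]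
          simp [next, hp]
      have hLs := hL s
      refine ⟨k + (L s - 1) + 1, by omega, ?_⟩
      rw [hq, hrun _ (by omega)]
      simp [next, show ¬ (L s - 1 + 1 < L s) by omega]
  refine ⟨fun k => c (q k).1 (q k).2, fun k => (q k).1, monotone_nat_of_le_succ fun k => ?_,
    fun s => ?_, fun k => hcA _ _ (hlt k).le, fun k => ?_⟩
  · rw [hq]
    by_cases hk : (q k).2 + 1 < L (q k).1 <;> simp [next, hk]
  · obtain ⟨k, hks, hk⟩ := hstart s
    exact ⟨k, hks, by simp [hk], by simp [hk, hc0]⟩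
  · have hR := hcR _ _ (hlt k)
    by_cases hk : (q k).2 + 1 < L (q k).1
    · simpa [hq, next, hk] using hR
    · have hlen : (q k).2 + 1 = L (q k).1 := by have := hlt k; omega
      rw [hlen, hcL] at hR
      simpa [hq, next, hk, hc0] using hR

/-- A sequence all of whose blocks of length `M` occur in points of a subshift lies in it, if the
subshift has a basis of forbidden words of length at most `M`. -/
theorem mem_of_forall_block {Λ : Type*} [TopologicalSpace Λ] [DiscreteTopology Λ]
    {Γ : Set (ℕ → Λ)} (hΓ : IsSubshift Γ) {F : Set (List Λ)} (hF : IsForbiddenBasis Γ F) {M : ℕ}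
    (hM : ∀ w ∈ F, w.length ≤ M) {x : ℕ → Λ} (h : ∀ k, ∃ y ∈ Γ, ∀ i < M, x (k + i) = y i) :
    x ∈ Γ := by
  rw [← hΓ.1.closure_eq, mem_closure_iff_agree]
  intro n
  have hall : Allowed Γ ((List.range n).map x) := by
    by_contra hnot
    obtain ⟨v, hvF, s, t, hst⟩ := hF.2 _ hnot
    obtain ⟨y, hy, hxy⟩ := h s.length
    refine hF.1 v hvF ⟨y, hy, 0, fun j hj => ?_⟩
    rw [zero_add, ← hxy j (hj.trans_le (hM v hvF)), List.get_eq_getElem]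
    have hlen := congrArg List.length hst
    simp only [List.length_append, List.length_map, List.length_range] at hlen
    have hget := congrArg (fun l : List Λ => l[s.length + j]?) hst
    simpa [List.getElem?_append, hj, show s.length + j < n by omega, List.getElem?_range]
      using hget.symm
  obtain ⟨y, hy, i, hyi⟩ := hall
  have hshift : ∀ i, shift^[i] y ∈ Γ := by
    intro i
    induction i with
    | zero => exact hy
    | succ i ih =>
      rw [Function.iterate_succ_apply', ← hΓ.2]
      exact mem_image_of_mem _ ih
  refine ⟨_, hshift i, fun j hj => ?_⟩
  rw [shift_iterate_apply, hyi j (by simpa using hj)]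
  simp

/-- If consecutive points `z k`, `z (k + 1)` form a chain of increasing precision `m k`, then the
sequence of first letters follows `z k` from time `k` on for `m k + 1` letters. -/
theorem first_letters_agree {Λ : Type*} {z : ℕ → ℕ → Λ} {m : ℕ → ℕ} (hm : Monotone m)
    (hz : ∀ k, ∀ i < m k, z k (i + 1) = z (k + 1) i) :
    ∀ j k, j ≤ m k → z (k + j) 0 = z k j := by
  intro j
  induction j with
  | zero => exact fun _ _ => rfl
  | succ j ih =>
    intro k hj
    rw [hz k j (by omega), ← ih (k + 1) ((by omega : j ≤ m k).trans (hm k.le_succ))]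
    rw [show k + (j + 1) = k + 1 + j by omega]

/-- Over a countable alphabet, there is a sequence in `Z` approximating every point of `Z`
infinitely often. -/
theorem exists_recurrent_seq {Λ : Type*} [TopologicalSpace Λ] [DiscreteTopology Λ] [Countable Λ]
    {Z : Set (ℕ → Λ)} (hne : Z.Nonempty) :
    ∃ t : ℕ → ℕ → Λ, (∀ s, t s ∈ Z) ∧ ∀ a ∈ Z, ∀ N n : ℕ, ∃ s ≥ N, ∀ i < n, t s i = a i := by
  have : Nonempty Z := hne.to_subtype
  refine ⟨fun s => TopologicalSpace.denseSeq Z s.unpair.1, fun s => Subtype.property _, ?_⟩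
  intro a ha N n
  have hopen : IsOpen (Subtype.val ⁻¹' PiNat.cylinder a n : Set Z) :=
    (PiNat.isOpen_cylinder (fun _ => Λ) a n).preimage continuous_subtype_val
  obtain ⟨l, hl⟩ := (TopologicalSpace.denseRange_denseSeq Z).exists_mem_open hopen
    ⟨⟨a, ha⟩, PiNat.self_mem_cylinder a n⟩
  refine ⟨Nat.pair l N, Nat.right_le_pair l N, ?_⟩
  simpa [PiNat.cylinder] using hl

/-- In a subshift of bounded type over a countable alphabet, every nonempty closed internally chain
transitive set is an attracting ω-limit set. -/
theorem exists_attracting_of_isICT {Λ : Type*} [TopologicalSpace Λ] [DiscreteTopology Λ]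
    [Countable Λ] {Γ : Set (ℕ → Λ)} (hΓ : IsSubshift Γ) (hSBT : IsSBT Γ) {Z : Set (ℕ → Λ)}
    (hZΓ : Z ⊆ Γ) (hne : Z.Nonempty) (hcl : IsClosed Z) (hICT : IsICT Z) :
    ∃ x ∈ Γ, omegaPt x = Z ∧
      ∀ ε : ℝ, 0 < ε → ∃ N : ℕ, ∀ i : ℕ, N ≤ i → bInfDist (shift^[i] x) Z < ε := by
  obtain ⟨F, ⟨M, hM⟩, hF⟩ := hSBT
  obtain ⟨t, htZ, ht⟩ := exists_recurrent_seq hne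
  obtain ⟨z, stage, hmono, hvisit, hzZ, hstep⟩ := exists_concat_chains
    (fun s u v => bDist (shift u) v < (2 : ℝ)⁻¹ ^ (M + s)) t
    fun s => hICT _ (htZ s) _ (htZ (s + 1)) _ (by positivity)
  have hx : ∀ k, ∀ i < M + stage k, z (k + i) 0 = z k i := fun k i hi =>
    first_letters_agree (fun a b hab => Nat.add_le_add_left (hmono hab) M)
      (fun k => agree_of_bDist_lt (hstep k)) i k hi.le
  have hstage : ∀ n, ∃ K, ∀ k ≥ K, n ≤ stage k := by
    intro n
    obtain ⟨K, -, hK, -⟩ := hvisit n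
    exact ⟨K, fun k hk => hK ▸ hmono hk⟩
  refine ⟨fun k => z k 0, mem_of_forall_block hΓ hF hM fun k =>
    ⟨z k, hZΓ (hzZ k), fun i hi => hx k i (by omega)⟩, ?_, ?_⟩
  · ext y
    rw [mem_omegaPt_iff_agree]
    constructor
    · intro hy
      rw [← hcl.closure_eq, mem_closure_iff_agree]
      intro n
      obtain ⟨K, hK⟩ := hstage n
      obtain ⟨k, hk, hky⟩ := hy K n
      have := hK k hk
      exact ⟨z k, hzZ k, fun i hi => by rw [← hx k i (by omega), hky i hi]⟩
    · intro hy N n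
      obtain ⟨s, hs, hts⟩ := ht y hy (max N n) n
      obtain ⟨k, hk, hks, hzk⟩ := hvisit s
      refine ⟨k, by omega, fun i hi => ?_⟩
      rw [hx k i (by omega), hzk, hts i hi]
  · intro ε hε
    obtain ⟨n, hn⟩ := exists_half_pow_lt hε
    obtain ⟨K, hK⟩ := hstage (n + 1)
    refine ⟨K, fun k hk => (bInfDist_lt_of_agree (hzZ k) fun i hi => ?_).trans hn⟩
    have := hK k hk
    rw [shift_iterate_apply, hx k i (by omega)]

/-- In a subshift of bounded type over a countable alphabet, a nonempty set `Z ⊆ Γ` is a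
closed internally chain transitive set iff it is an attracting ω-limit set of `(Γ, σ)`. -/
theorem sbt_closedICT_iff_attracting_omega {Λ : Type*} [TopologicalSpace Λ]
    [DiscreteTopology Λ] [Countable Λ] (Γ : Set (ℕ → Λ)) (hΓ : IsSubshift Γ) (hSBT : IsSBT Γ)
    (Z : Set (ℕ → Λ)) (hZΓ : Z ⊆ Γ) (hne : Z.Nonempty) :
    (IsClosed Z ∧ IsICT Z) ↔
      ∃ x ∈ Γ, omegaPt x = Z ∧
        ∀ ε : ℝ, 0 < ε → ∃ N : ℕ, ∀ i : ℕ, N ≤ i → bInfDist (shift^[i] x) Z < ε := by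
  constructor
  · rintro ⟨hcl, hICT⟩
    exact exists_attracting_of_isICT hΓ hSBT hZΓ hne hcl hICT
  · rintro ⟨x, -, rfl, hatt⟩
    exact ⟨isClosed_omegaPt x, isICT_omegaPt x hatt⟩
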